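/- Let G be a minor-minimal enemy. Then |E(G)| = 4|V(G)| − 8. -/

import Mathlib

open SimpleGraph

/-- `K7vee` is the graph obtained from `K 7` by deleting two edges with a common end. -/
def K7vee : SimpleGraph (Fin 7) :=
  (completeGraph (Fin 7)).deleteEdges {s(0, 1), s(0, 2)}

/-- `K6vee` is the graph obtained from `K 6` by deleting two edges with a common end. -/
def K6vee : SimpleGraph (Fin 6) :=
  (completeGraph (Fin 6)).deleteEdges {s(0, 1), s(0, 2)}

/-- The complete multipartite graph with four parts of size two. -/
def K2222 : SimpleGraph (Fin 4 × Fin 2) :=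
  SimpleGraph.comap Prod.fst (completeGraph (Fin 4))

/-- `H` is a minor of `G`: there is a model of `H` in `G`, i.e. a family of pairwise disjoint
nonempty connected branch sets, one for each vertex of `H`, with edges of `G` between branch
sets corresponding to adjacent vertices of `H`. -/
def IsMinor {W V : Type} (H : SimpleGraph W) (G : SimpleGraph V) : Prop :=
  ∃ bag : W → Set V,
    (∀ w, (G.induce (bag w)).Connected) ∧
    (∀ w w', w ≠ w' → Disjoint (bag w) (bag w')) ∧
    (∀ w w', H.Adj w w' → ∃ u ∈ bag w, ∃ v ∈ bag w', G.Adj u v)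

/-- A graph is `k`-connected if it has more than `k` vertices and stays connected after
removing any set of fewer than `k` vertices. -/
def IsKConnected {V : Type} [Fintype V] (k : ℕ) (G : SimpleGraph V) : Prop :=
  k < Fintype.card V ∧ ∀ S : Set V, S.ncard < k → (G.induce (Sᶜ : Set V)).Connected

/-- A separation of `G`: `A ∪ B = V(G)` and no edge joins `A - B` to `B - A`. -/
def IsSeparation {V : Type} (G : SimpleGraph V) (A B : Set V) : Prop :=
  A ∪ B = Set.univ ∧ ∀ ⦃u v : V⦄, G.Adj u v → ¬(u ∈ A \ B ∧ v ∈ B \ A)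

/-- `(G, Z)` is internally `k`-connected: every separation `(A,B)` of `G` with `Z ⊆ A`
and `B - A ≠ ∅` has order at least `k`. -/
def InternallyConnected {V : Type} (G : SimpleGraph V) (Z : Set V) (k : ℕ) : Prop :=
  ∀ A B : Set V, IsSeparation G A B → Z ⊆ A → (B \ A).Nonempty →
    k ≤ (A ∩ B).ncard

/-- A `Z`-rooted `K₄`-model in `G`. -/
def HasRootedK4Model {V : Type} (G : SimpleGraph V) (Z : Set V) : Prop :=
  ∃ B : Fin 4 → Set V,
    (∀ i, (G.induce (B i)).Connected) ∧
    (∀ i j, i ≠ j → Disjoint (B i) (B j)) ∧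
    (∀ i, ∃! z : V, z ∈ Z ∧ z ∈ B i) ∧
    (∀ z ∈ Z, ∃ i, z ∈ B i) ∧
    (∀ i j, i ≠ j → ∃ u ∈ B i, ∃ v ∈ B j, G.Adj u v)

/-- A `Z`-rooted `K*₄,₂`-model in `G`. -/
def HasRootedK42starModel {V : Type} (G : SimpleGraph V) (Z : Set V) : Prop :=
  ∃ (B : Fin 4 → Set V) (C : Fin 2 → Set V),
    (∀ i, (G.induce (B i)).Connected) ∧
    (∀ j, (G.induce (C j)).Connected) ∧
    (∀ i j, i ≠ j → Disjoint (B i) (B j)) ∧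
    (∀ i j, i ≠ j → Disjoint (C i) (C j)) ∧
    (∀ i j, Disjoint (B i) (C j)) ∧
    (∀ i, ∃! z : V, z ∈ Z ∧ z ∈ B i) ∧
    (∀ z ∈ Z, ∃ i, z ∈ B i) ∧
    (∀ i j, ∃ u ∈ B i, ∃ v ∈ C j, G.Adj u v) ∧
    (∃ u ∈ C 0, ∃ v ∈ C 1, G.Adj u v)

/-- An enemy: a `4`-connected graph with `|E(G)| ≥ 4|V(G)| - 8`, with no `K7vee`-minor,
not isomorphic to `K_{2,2,2,2}`. -/
def Enemy {V : Type} [Fintype V] (G : SimpleGraph V) : Prop :=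
  IsKConnected 4 G ∧
    4 * (Fintype.card V : ℤ) - 8 ≤ (G.edgeSet.ncard : ℤ) ∧
    ¬ IsMinor K7vee G ∧
    IsEmpty (G ≃g K2222)

/-- A minor-minimal enemy: an enemy, no minor of which, other than itself, is an enemy. -/
def MinorMinimalEnemy {V : Type} [Fintype V] (G : SimpleGraph V) : Prop :=
  Enemy G ∧ ∀ (W : Type) [Fintype W] (H : SimpleGraph W),
    IsMinor H G → Enemy H → Nonempty (H ≃g G)

/-- The simple graph obtained from `G` by contracting the edge `uv`
(`v` is merged into `u`). -/
def contractEdge {V : Type} (G : SimpleGraph V) (u v : V) :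
    SimpleGraph {x : V // x ≠ v} :=
  SimpleGraph.fromRel (fun x y => G.Adj ↑x ↑y ∨ ((x : V) = u ∧ G.Adj v ↑y))

/-- A graph is `7`-contraction-critical if its chromatic number is `7` and
every minor of it, other than itself, has chromatic number less than `7`. -/
def ContractionCritical7 {V : Type} [Fintype V] (G : SimpleGraph V) : Prop :=
  G.chromaticNumber = 7 ∧
    ∀ (W : Type) [Fintype W] (H : SimpleGraph W),
      IsMinor H G → IsEmpty (H ≃g G) → H.chromaticNumber < 7

/-- The edge `xy` is the only edge of `G` between the disjoint sets `A ∋ x` and `B ∋ y`, and fewer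
than `k` vertices lie outside `A ∪ B`. -/
structure IsEdgeCut {V : Type} [Fintype V] [DecidableEq V] (G : SimpleGraph V) (k : ℕ) (x y : V)
    (A B : Finset V) : Prop where
  left_mem : x ∈ A
  right_mem : y ∈ B
  disjoint : Disjoint A B
  card_lt : ((A ∪ B)ᶜ).card < k
  eq_of_adj : ∀ u ∈ A, ∀ v ∈ B, G.Adj u v → u = x ∧ v = y

theorem SimpleGraph.sum_ncard_neighborSet_eq {V : Type*} [Fintype V] (G : SimpleGraph V) :
    ∑ v, (G.neighborSet v).ncard = 2 * G.edgeSet.ncard := by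
  classical
  rw [← SimpleGraph.coe_edgeFinset, Set.ncard_coe_finset, ← G.sum_degrees_eq_twice_card_edges]
  refine Finset.sum_congr rfl fun v _ => ?_
  rw [← Nat.card_coe_set_eq, Nat.card_eq_fintype_card, SimpleGraph.card_neighborSet_eq_degree]

section Mader

variable {V : Type} [Fintype V] [DecidableEq V] {G : SimpleGraph V} {k : ℕ}

theorem IsEdgeCut.symm {x y : V} {A B : Finset V} (h : IsEdgeCut G k x y A B) :
    IsEdgeCut G k y x B A where
  left_mem := h.right_mem
  right_mem := h.left_mem
  disjoint := h.disjoint.symm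
  card_lt := by rw [Finset.union_comm]; exact h.card_lt
  eq_of_adj u hu v hv huv := (h.eq_of_adj v hv u hu huv.symm).symm

/-- In a graph whose induced subgraph on `T` is preconnected, an edge leaves every nonempty proper
subset of `T`. -/
theorem SimpleGraph.Preconnected.exists_adj_mem_notMem {W : Type*} {H : SimpleGraph W}
    (h : H.Preconnected) {P : Set W} {a b : W} (ha : a ∈ P) (hb : b ∉ P) :
    ∃ u ∈ P, ∃ v ∉ P, H.Adj u v := by
  by_contra! hP
  have key : ∀ {c d : W}, H.Walk c d → c ∈ P → d ∈ P := by
    intro c d p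
    induction p with
    | nil => exact id
    | cons hcd _ ih => exact fun hc => ih (by_contra fun hd => hP _ hc _ hd hcd)
  exact hb (key (h a b).some ha)

/-- In a `k`-connected graph, nonempty sets with no edges between them are separated by at least
`k` vertices. -/
theorem IsKConnected.le_card_compl_union (hG : IsKConnected k G) {P Q : Finset V}
    (hP : P.Nonempty) (hQ : Q.Nonempty) (hPQ : Disjoint P Q)
    (hadj : ∀ u ∈ P, ∀ v ∈ Q, ¬ G.Adj u v) : k ≤ ((P ∪ Q)ᶜ).card := by
  by_contra! hlt
  have hconn := hG.2 (((P ∪ Q)ᶜ : Finset V) : Set V) (by rwa [Set.ncard_coe_finset])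
  obtain ⟨a, ha⟩ := hP
  obtain ⟨b, hb⟩ := hQ
  obtain ⟨u, hu, v, hv, huv⟩ := hconn.preconnected.exists_adj_mem_notMem
    (P := {w | (w : V) ∈ P}) (a := ⟨a, by simp [ha]⟩) (b := ⟨b, by simp [hb]⟩) ha
    (Finset.disjoint_right.1 hPQ hb)
  have hvPQ : (v : V) ∈ P ∨ (v : V) ∈ Q := by
    simpa [-Subtype.coe_prop, or_iff_not_imp_left] using v.2
  exact hadj u hu v (hvPQ.resolve_left hv) huv

/-- If deleting the edge `xy` destroys `k`-connectedness, then `xy` belongs to an edge cut. -/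
theorem IsKConnected.exists_isEdgeCut (hG : IsKConnected k G) {x y : V}
    (h : ¬ IsKConnected k (G.deleteEdges {s(x, y)})) :
    ∃ A B : Finset V, IsEdgeCut G k x y A B := by
  have h' : ∃ S : Set V, S.ncard < k ∧
      ¬ ((G.deleteEdges {s(x, y)}).induce (Sᶜ : Set V)).Connected := by
    by_contra! hS
    exact h ⟨hG.1, hS⟩
  obtain ⟨S, hS, hdis⟩ := h'
  have hconn := hG.2 S hS
  have hne := hconn.nonempty
  have hpre : ¬ ((G.deleteEdges {s(x, y)}).induce (Sᶜ : Set V)).Preconnected :=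
    fun hp => hdis ⟨hp⟩
  obtain ⟨a, b, hab⟩ : ∃ a b, ¬ ((G.deleteEdges {s(x, y)}).induce (Sᶜ : Set V)).Reachable a b := by
    by_contra! hr
    exact hpre hr
  classical
  set P : Set (Sᶜ : Set V) :=
    {w | ((G.deleteEdges {s(x, y)}).induce (Sᶜ : Set V)).Reachable a w} with hPdef
  have hclosed : ∀ u ∈ P, ∀ v ∉ P, G.Adj u v → s((u : V), (v : V)) = s(x, y) := by
    intro u hu v hv huv
    by_contra hne
    refine hv (SimpleGraph.Reachable.trans hu (SimpleGraph.Adj.reachable ?_))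
    simpa [SimpleGraph.deleteEdges_adj, huv] using hne
  obtain ⟨u, hu, v, hv, huv⟩ := hconn.preconnected.exists_adj_mem_notMem (P := P)
    (SimpleGraph.Reachable.refl a) hab
  have huv' : s((u : V), (v : V)) = s(x, y) := hclosed u hu v hv huv
  have hcut : IsEdgeCut G k (u : V) (v : V)
      (Finset.univ.filter fun w => ∃ hw : w ∈ (Sᶜ : Set V), (⟨w, hw⟩ : (Sᶜ : Set V)) ∈ P)
      (Finset.univ.filter fun w => ∃ hw : w ∈ (Sᶜ : Set V), (⟨w, hw⟩ : (Sᶜ : Set V)) ∉ P) := by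
    refine ⟨?_, ?_, ?_, ?_, ?_⟩
    · exact Finset.mem_filter.2 ⟨Finset.mem_univ _, u.2, hu⟩
    · exact Finset.mem_filter.2 ⟨Finset.mem_univ _, v.2, hv⟩
    · rw [Finset.disjoint_left]
      intro w hw hw'
      obtain ⟨-, h1, h2⟩ := Finset.mem_filter.1 hw
      obtain ⟨-, h3, h4⟩ := Finset.mem_filter.1 hw'
      exact h4 h2
    · rw [← Set.ncard_coe_finset]
      refine lt_of_le_of_lt (Set.ncard_le_ncard ?_ (Set.toFinite S)) hS
      intro w hw
      by_contra hwS
      rw [Finset.mem_coe, Finset.mem_compl, Finset.mem_union, not_or] at hw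
      by_cases hwP : (⟨w, hwS⟩ : (Sᶜ : Set V)) ∈ P
      · exact hw.1 (Finset.mem_filter.2 ⟨Finset.mem_univ _, hwS, hwP⟩)
      · exact hw.2 (Finset.mem_filter.2 ⟨Finset.mem_univ _, hwS, hwP⟩)
    · intro c hc d hd hcd
      obtain ⟨-, hc1, hc2⟩ := Finset.mem_filter.1 hc
      obtain ⟨-, hd1, hd2⟩ := Finset.mem_filter.1 hd
      have hcd' : s(c, d) = s(x, y) := hclosed _ hc2 _ hd2 hcd
      rw [← huv', Sym2.eq_iff] at hcd'
      rcases hcd' with hcd' | ⟨rfl, rfl⟩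
      · exact hcd'
      · exact absurd hu hd2
  rcases Sym2.eq_iff.1 huv' with ⟨h1, h2⟩ | ⟨h1, h2⟩
  · exact ⟨_, _, h1 ▸ h2 ▸ hcut⟩
  · exact ⟨_, _, h1 ▸ h2 ▸ hcut.symm⟩

theorem Finset.card_eq_card_inter_add_of_disjoint {A B : Finset V} (hAB : Disjoint A B)
    (T : Finset V) :
    T.card = (T ∩ A).card + (T ∩ B).card + (T ∩ (A ∪ B)ᶜ).card := by
  rw [← Finset.card_union_of_disjoint
    (hAB.mono Finset.inter_subset_right Finset.inter_subset_right),
    ← Finset.inter_union_distrib_left, ← Finset.sdiff_eq_inter_compl, Finset.card_inter_add_card_sdiff]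

/-- Mader's descent: along a nonbacktracking walk `x, y, z` through a vertex `y` of degree greater
than `k`, the far sides of edge cuts of a `k`-connected graph shrink. -/
theorem IsKConnected.card_lt_card_of_isEdgeCut (hG : IsKConnected k G) {x y z : V}
    (hxy : G.Adj x y) (hyz : G.Adj y z) (hxz : x ≠ z) (hdeg : k < (G.neighborSet y).ncard)
    {A₁ B₁ A₂ B₂ : Finset V} (h₁ : IsEdgeCut G k x y A₁ B₁) (h₂ : IsEdgeCut G k y z A₂ B₂) :
    B₂.card < B₁.card := by
  have hd₁ := Finset.disjoint_left.1 h₁.disjoint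
  have hd₂ := Finset.disjoint_left.1 h₂.disjoint
  have hxB : x ∉ B₂ := fun hx => hxz (h₂.eq_of_adj y h₂.left_mem x hx hxy.symm).2
  have hzA : z ∉ A₁ := fun hz => hxz (h₁.eq_of_adj z hz y h₁.right_mem hyz.symm).1.symm
  set S₁ := (A₁ ∪ B₁)ᶜ with hS₁
  set S₂ := (A₂ ∪ B₂)ᶜ with hS₂
  have mS₁ : ∀ v, v ∈ S₁ ↔ v ∉ A₁ ∧ v ∉ B₁ := by simp [hS₁]
  have mS₂ : ∀ v, v ∈ S₂ ↔ v ∉ A₂ ∧ v ∉ B₂ := by simp [hS₂]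
  have hc₁ := h₁.card_lt
  have hc₂ := h₂.card_lt
  rw [← hS₁] at hc₁
  rw [← hS₂] at hc₂
  have pS₁ := Finset.card_eq_card_inter_add_of_disjoint h₂.disjoint S₁
  have pS₂ := Finset.card_eq_card_inter_add_of_disjoint h₁.disjoint S₂
  have pB₁ := Finset.card_eq_card_inter_add_of_disjoint h₂.disjoint B₁
  have pB₂ := Finset.card_eq_card_inter_add_of_disjoint h₁.disjoint B₂
  rw [← hS₂] at pS₁ pB₁
  rw [← hS₁] at pS₂ pB₂
  rw [Finset.inter_comm S₂ S₁] at pS₂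
  rw [Finset.inter_comm B₂ B₁] at pB₂
  have hY : k ≤ (B₁ ∩ S₂).card + (S₁ ∩ A₂).card + (S₁ ∩ S₂).card + 1 := by
    have hYle : (B₁ ∩ S₂ ∪ S₁ ∩ A₂ ∪ S₁ ∩ S₂).card ≤
        (B₁ ∩ S₂).card + (S₁ ∩ A₂).card + (S₁ ∩ S₂).card :=
      (Finset.card_union_le _ _).trans (Nat.add_le_add_right (Finset.card_union_le _ _) _)
    set Y := B₁ ∩ S₂ ∪ S₁ ∩ A₂ ∪ S₁ ∩ S₂ with hYdef
    have mY : ∀ v, v ∈ Y ↔ v ∉ A₁ ∧ v ∉ B₂ ∧ ¬ (v ∈ B₁ ∧ v ∈ A₂) := by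
      intro v
      have := @hd₁ v
      have := @hd₂ v
      simp only [hYdef, Finset.mem_union, Finset.mem_inter, mS₁, mS₂]
      tauto
    rcases ((B₁ ∩ A₂).erase y).eq_empty_or_nonempty with hP | hP
    · have hsub : G.neighborSet y ⊆ ((insert x (insert z Y) : Finset V) : Set V) := by
        intro v hv
        have hv : G.Adj y v := hv
        rw [Finset.mem_coe, Finset.mem_insert, Finset.mem_insert, mY]
        by_cases hvA : v ∈ A₁
        · exact Or.inl (h₁.eq_of_adj v hvA y h₁.right_mem hv.symm).1
        by_cases hvB : v ∈ B₂
        · exact Or.inr (Or.inl (h₂.eq_of_adj y h₂.left_mem v hvB hv).2)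
        refine Or.inr (Or.inr ⟨hvA, hvB, fun hvv => ?_⟩)
        have : v ∈ (B₁ ∩ A₂).erase y :=
          Finset.mem_erase.2 ⟨hv.ne', Finset.mem_inter.2 hvv⟩
        rw [hP] at this
        exact Finset.notMem_empty _ this
      have h1 := Set.ncard_le_ncard hsub (Finset.finite_toSet _)
      rw [Set.ncard_coe_finset] at h1
      have h2 := Finset.card_insert_le x (insert z Y)
      have h3 := Finset.card_insert_le z Y
      omega
    · have hle := hG.le_card_compl_union hP (Q := A₁ ∪ B₂)
        ⟨x, Finset.mem_union_left _ h₁.left_mem⟩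
        (by
          rw [Finset.disjoint_left]
          intro v hv hv'
          rw [Finset.mem_erase, Finset.mem_inter] at hv
          rcases Finset.mem_union.1 hv' with hv' | hv'
          · exact hd₁ hv' hv.2.1
          · exact hd₂ hv.2.2 hv')
        (by
          intro u hu v hv huv
          rw [Finset.mem_erase, Finset.mem_inter] at hu
          rcases Finset.mem_union.1 hv with hv | hv
          · exact hu.1 (h₁.eq_of_adj v hv u hu.2.1 huv.symm).2
          · exact hu.1 (h₂.eq_of_adj u hu.2.2 v hv huv).1)
      have hsub : ((B₁ ∩ A₂).erase y ∪ (A₁ ∪ B₂))ᶜ ⊆ insert y Y := by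
        intro v hv
        simp only [Finset.mem_compl, Finset.mem_union, Finset.mem_erase, Finset.mem_inter] at hv
        rw [Finset.mem_insert, mY]
        tauto
      have h1 := Finset.card_le_card hsub
      have h2 := Finset.card_insert_le y Y
      omega
  have hX : A₁ ∩ B₂ = ∅ := by
    by_contra hne
    have hle := hG.le_card_compl_union (Finset.nonempty_iff_ne_empty.2 hne) (Q := B₁ ∪ A₂)
      ⟨y, Finset.mem_union_left _ h₁.right_mem⟩
      (by
        rw [Finset.disjoint_left]
        intro v hv hv'
        rw [Finset.mem_inter] at hv
        rcases Finset.mem_union.1 hv' with hv' | hv'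
        · exact hd₁ hv.1 hv'
        · exact hd₂ hv' hv.2)
      (by
        intro u hu v hv huv
        rw [Finset.mem_inter] at hu
        rcases Finset.mem_union.1 hv with hv | hv
        · exact hxB ((h₁.eq_of_adj u hu.1 v hv huv).1 ▸ hu.2)
        · exact hzA ((h₂.eq_of_adj v hv u hu.2 huv.symm).2 ▸ hu.1))
    have hsub : (A₁ ∩ B₂ ∪ (B₁ ∪ A₂))ᶜ ⊆ S₂ ∩ A₁ ∪ S₁ ∩ B₂ ∪ S₁ ∩ S₂ := by
      intro v hv
      simp only [Finset.mem_compl, Finset.mem_union, Finset.mem_inter] at hv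
      simp only [Finset.mem_union, Finset.mem_inter, mS₁, mS₂]
      tauto
    have h1 := Finset.card_le_card hsub
    have h2 := Finset.card_union_le (S₂ ∩ A₁ ∪ S₁ ∩ B₂) (S₁ ∩ S₂)
    have h3 := Finset.card_union_le (S₂ ∩ A₁) (S₁ ∩ B₂)
    rw [Finset.inter_comm S₂ B₁] at pS₂
    omega
  have hy : 0 < (B₁ ∩ A₂).card :=
    Finset.card_pos.2 ⟨y, Finset.mem_inter.2 ⟨h₁.right_mem, h₂.left_mem⟩⟩
  rw [Finset.inter_comm B₂ A₁, hX, Finset.card_empty, Finset.inter_comm B₂ S₁] at pB₂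
  omega

/-- If no edge of a `k`-connected graph can be deleted, then its number of edges is at most `k`
times the number of vertices of degree at most `k` plus the number of vertices of larger degree. -/
theorem IsKConnected.ncard_edgeSet_le (hG : IsKConnected k G)
    (hmin : ∀ x y, G.Adj x y → ¬ IsKConnected k (G.deleteEdges {s(x, y)})) :
    G.edgeSet.ncard ≤ ∑ v, if k < (G.neighborSet v).ncard then 1 else k := by
  choose! A B hAB using fun x y (h : G.Adj x y) => hG.exists_isEdgeCut (hmin x y h)
  let assigned (v : V) : Set (Sym2 V) :=
    if k < (G.neighborSet v).ncard then
      {e | ∃ x, e = s(x, v) ∧ G.Adj x v ∧ (B x v).card ≤ (B v x).card}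
    else (fun x => s(x, v)) '' G.neighborSet v
  have hcover : G.edgeSet ⊆ ⋃ v ∈ (Finset.univ : Finset V), assigned v := by
    intro e he
    induction e with
    | _ x y =>
      rw [SimpleGraph.mem_edgeSet] at he
      simp only [Set.mem_iUnion, Finset.mem_univ, exists_prop, true_and]
      wlog hle : (B x y).card ≤ (B y x).card generalizing x y
      · rw [Sym2.eq_swap]
        exact this y x he.symm (le_of_not_ge hle)
      refine ⟨y, ?_⟩
      simp only [assigned]
      split_ifs
      · exact ⟨x, rfl, he, hle⟩
      · exact ⟨x, he.symm, rfl⟩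
  refine (Set.ncard_le_ncard hcover (Set.toFinite _)).trans ?_
  refine (Finset.set_ncard_biUnion_le _ _).trans (Finset.sum_le_sum fun v _ => ?_)
  simp only [assigned]
  split_ifs with hv
  · rw [Set.ncard_le_one_iff]
    rintro _ _ ⟨x, rfl, hx, hxle⟩ ⟨z, rfl, hz, hzle⟩
    by_contra hne
    have hxz : x ≠ z := fun h => hne (h ▸ rfl)
    have h1 := hG.card_lt_card_of_isEdgeCut hx hz.symm hxz hv (hAB _ _ hx) (hAB _ _ hz.symm)
    have h2 := hG.card_lt_card_of_isEdgeCut hz hx.symm hxz.symm hv (hAB _ _ hz)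
      (hAB _ _ hx.symm)
    omega
  · exact (Set.ncard_image_le (Set.toFinite _)).trans (not_lt.1 hv)

/-- A `4`-connected graph none of whose edges can be deleted has at most `4|V(G)| - 8` edges. -/
theorem IsKConnected.ncard_edgeSet_add_eight_le (hG : IsKConnected 4 G)
    (hmin : ∀ x y, G.Adj x y → ¬ IsKConnected 4 (G.deleteEdges {s(x, y)})) :
    G.edgeSet.ncard + 8 ≤ 4 * Fintype.card V := by
  have hcard := hG.1
  have hle := hG.ncard_edgeSet_le hmin
  have hdeg := G.sum_ncard_neighborSet_eq
  set F := Finset.univ.filter fun v => 4 < (G.neighborSet v).ncard with hF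
  have hsum : ∀ a b : ℕ, (∑ v, if 4 < (G.neighborSet v).ncard then a else b) =
      F.card * a + (Fintype.card V - F.card) * b := by
    intro a b
    rw [Finset.sum_ite, Finset.sum_const, Finset.sum_const, smul_eq_mul, smul_eq_mul,
      Finset.filter_not, Finset.card_sdiff_of_subset (Finset.filter_subset _ _), Finset.card_univ]
  have hdle : ∑ v, (G.neighborSet v).ncard ≤
      ∑ v, if 4 < (G.neighborSet v).ncard then Fintype.card V - 1 else 4 := by
    refine Finset.sum_le_sum fun v _ => ?_
    split_ifs with hv
    · have hsub : G.neighborSet v ⊆ ((Finset.univ.erase v : Finset V) : Set V) := by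
        intro w hw
        simpa using (show G.Adj v w from hw).ne'
      have := Set.ncard_le_ncard hsub (Finset.finite_toSet _)
      rwa [Set.ncard_coe_finset, Finset.card_erase_of_mem (Finset.mem_univ v),
        Finset.card_univ] at this
    · exact not_lt.1 hv
  rw [hsum] at hle hdle
  rw [hdeg] at hdle
  have hFle : F.card ≤ Fintype.card V := Finset.card_le_univ F
  by_cases h3 : 3 ≤ F.card
  · omega
  · have : F.card = 0 ∨ F.card = 1 ∨ F.card = 2 := by omega
    rcases this with h | h | h <;> rw [h] at hdle <;> omega

end Mader

theorem IsMinor.of_le {V : Type} {H G : SimpleGraph V} (h : H ≤ G) : IsMinor H G := by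
  refine ⟨fun v => {v}, fun v => ?_, fun v w hvw => Set.disjoint_singleton.2 hvw,
    fun v w hvw => ⟨v, rfl, w, rfl, h hvw⟩⟩
  exact SimpleGraph.Connected.of_subsingleton

theorem IsMinor.mono_right {W V : Type} {K : SimpleGraph W} {H G : SimpleGraph V}
    (hK : IsMinor K H) (h : H ≤ G) : IsMinor K G := by
  obtain ⟨bag, hconn, hdisj, hadj⟩ := hK
  refine ⟨bag, fun w => (hconn w).mono fun a b hab => h hab, hdisj, fun w w' hww' => ?_⟩
  obtain ⟨u, hu, v, hv, huv⟩ := hadj w w' hww'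
  exact ⟨u, hu, v, hv, h huv⟩

/-- Branch sets of a model of `K7vee` in the graph obtained from `K2222` by joining the two vertices
of its `i`-th part. -/
def K2222AddEdgeBag (i : Fin 4) : Fin 7 → Finset (Fin 4 × Fin 2) :=
  ![{(i + 1, 0)}, {(i + 1, 1)}, {(i, 0)}, {(i, 1)}, {(i + 2, 0), (i + 3, 0)}, {(i + 2, 1)},
    {(i + 3, 1)}]

/-- Adding an edge to `K2222` creates a `K7vee`-minor. -/
theorem isMinor_K7vee_of_deleteEdges_iso {V : Type} {G : SimpleGraph V} {x y : V}
    (hxy : G.Adj x y) (φ : G.deleteEdges {s(x, y)} ≃g K2222) : IsMinor K7vee G := by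
  have hK : ∀ a b : Fin 4 × Fin 2, K2222.Adj a b ↔ a.1 ≠ b.1 := fun a b => Iff.rfl
  have hpart : (φ x).1 = (φ y).1 := by
    by_contra hne
    have := φ.map_adj_iff.1 ((hK _ _).2 hne)
    simp [SimpleGraph.deleteEdges_adj] at this
  have hadj : ∀ a b : Fin 4 × Fin 2, a ≠ b → (a.1 = b.1 → a.1 = (φ x).1) →
      G.Adj (φ.symm a) (φ.symm b) := by
    intro a b hab h
    by_cases hne : a.1 = b.1
    · have h2 : (φ x).2 ≠ (φ y).2 := fun h2 => hxy.ne (φ.injective (Prod.ext hpart h2))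
      have hab2 : a.2 ≠ b.2 := fun h2 => hab (Prod.ext hne h2)
      have hax := h hne
      have hor : (a.2 = (φ x).2 ∧ b.2 = (φ y).2) ∨ (a.2 = (φ y).2 ∧ b.2 = (φ x).2) := by
        omega
      rcases hor with ⟨h3, h4⟩ | ⟨h3, h4⟩
      · rw [show a = φ x from Prod.ext hax h3,
          show b = φ y from Prod.ext (hne.symm.trans (hax.trans hpart)) h4]
        simpa using hxy
      · rw [show a = φ y from Prod.ext (hax.trans hpart) h3,
          show b = φ x from Prod.ext (hne.symm.trans hax) h4]
        simpa using hxy.symm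
    · have : (G.deleteEdges {s(x, y)}).Adj (φ.symm a) (φ.symm b) :=
        φ.symm.map_adj_iff.2 ((hK _ _).2 hne)
      exact SimpleGraph.deleteEdges_le _ this
  generalize (φ x).1 = i at hadj
  have hinj : Function.Injective φ.symm := φ.symm.injective
  refine ⟨fun w => φ.symm '' (K2222AddEdgeBag i w : Set (Fin 4 × Fin 2)), ?_, ?_, ?_⟩
  · intro w
    have hne : ∀ (i : Fin 4) (w : Fin 7), (K2222AddEdgeBag i w).Nonempty := by decide
    have hcl : ∀ (i : Fin 4) (w : Fin 7), ∀ a ∈ K2222AddEdgeBag i w, ∀ b ∈ K2222AddEdgeBag i w,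
        a.1 = b.1 → a = b := by decide
    obtain ⟨c, hc⟩ := hne i w
    have : Nonempty (φ.symm '' (K2222AddEdgeBag i w : Set (Fin 4 × Fin 2))) :=
      ⟨⟨_, c, hc, rfl⟩⟩
    refine ⟨?_⟩
    rintro ⟨_, a, ha, rfl⟩ ⟨_, b, hb, rfl⟩
    by_cases hab : a = b
    · subst hab
      exact SimpleGraph.Reachable.refl _
    · exact SimpleGraph.Adj.reachable
        (hadj a b hab fun h => absurd (hcl i w a ha b hb h) hab)
  · intro w w' hww'
    have hdisj : ∀ (i : Fin 4) (w w' : Fin 7), w ≠ w' →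
        Disjoint (K2222AddEdgeBag i w) (K2222AddEdgeBag i w') := by decide
    exact (Set.disjoint_image_iff hinj).2 (Finset.disjoint_coe.2 (hdisj i w w' hww'))
  · intro w w' hww'
    have hbag : ∀ (i : Fin 4) (w w' : Fin 7), w ≠ w' → ¬ (w = 0 ∧ w' = 1) → ¬ (w = 1 ∧ w' = 0) →
        ∃ a ∈ K2222AddEdgeBag i w, ∃ b ∈ K2222AddEdgeBag i w', a ≠ b ∧ (a.1 = b.1 → a.1 = i) := by
      decide
    have hnot : ¬ (w = 0 ∧ w' = 1) ∧ ¬ (w = 1 ∧ w' = 0) := by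
      constructor <;> rintro ⟨rfl, rfl⟩ <;> simp [K7vee] at hww'
    obtain ⟨a, ha, b, hb, hab, h⟩ := hbag i w w' hww'.ne hnot.1 hnot.2
    exact ⟨_, ⟨a, ha, rfl⟩, _, ⟨b, hb, rfl⟩, hadj a b hab h⟩

/-- No edge deletion in a minor-minimal enemy with more than `4|V(G)| - 8` edges keeps it
`4`-connected. -/
theorem MinorMinimalEnemy.not_isKConnected_deleteEdges {V : Type} [Fintype V] {G : SimpleGraph V}
    (h : MinorMinimalEnemy G) (hlt : 4 * (Fintype.card V : ℤ) - 8 < (G.edgeSet.ncard : ℤ))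
    {x y : V} (hxy : G.Adj x y) : ¬ IsKConnected 4 (G.deleteEdges {s(x, y)}) := by
  intro hconn
  have hcard : (G.deleteEdges {s(x, y)}).edgeSet.ncard + 1 = G.edgeSet.ncard := by
    rw [SimpleGraph.edgeSet_deleteEdges]
    exact Set.ncard_sdiff_singleton_add_one ((SimpleGraph.mem_edgeSet G).2 hxy) (Set.toFinite _)
  have hle : G.deleteEdges {s(x, y)} ≤ G := SimpleGraph.deleteEdges_le _
  have henemy : Enemy (G.deleteEdges {s(x, y)}) :=
    ⟨hconn, by omega, fun hK => h.1.2.2.1 (hK.mono_right hle),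
      ⟨fun φ => h.1.2.2.1 (isMinor_K7vee_of_deleteEdges_iso hxy φ)⟩⟩
  obtain ⟨φ⟩ := h.2 V _ (IsMinor.of_le hle) henemy
  have := Nat.card_congr φ.mapEdgeSet
  rw [Nat.card_coe_set_eq, Nat.card_coe_set_eq] at this
  omega

/-- a minor-minimal enemy satisfies `|E(G)| = 4|V(G)| - 8`. -/
theorem statement_13 (V : Type) [Fintype V] (G : SimpleGraph V)
    (h : MinorMinimalEnemy G) :
    (G.edgeSet.ncard : ℤ) = 4 * (Fintype.card V : ℤ) - 8 := by
  classical
  refine le_antisymm (not_lt.1 fun hlt => ?_) h.1.2.1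
  have := h.1.1.ncard_edgeSet_add_eight_le fun x y hxy => h.not_isKConnected_deleteEdges hlt hxy
  omega
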